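/- arXiv:0709.1914 — 3 statements merged into one kernel-verified Lean document; each statement's English description precedes it below -/
import Mathlib

section
/- Let α be an irrational number satisfying a Diophantine condition (α ∈ CD) and let β be a real number such that the pair (α,β) does NOT satisfy the Diophantine condition CD₁. Then for every ε > 0 and every r ∈ ℕ there exists a C^∞ function a : 𝕋¹ → ℂ with C^r norm smaller than ε such that, for every t ∈ ℂ, the fibered holomorphic dynamics F_t(θ,z) = (θ+α, t·a(θ) + t·e^{2πiβ}·z) possesses no C^∞ invariant curve of degree zero whose transversal rotation number equals β; equivalently, there is no C^∞ function u : 𝕋¹ → ℂ and no t ∈ ℂ with (1/2πi)log(t e^{2πiβ}) ≡ β (mod 1) satisfying t·a(θ) + t·e^{2πiβ}·u(θ) = u(θ+α) for all θ. -/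
open MeasureTheory Metric Complex Real Set Function

noncomputable section

/-- Distance from a real number to the nearest integer. -/
def distInt (x : ℝ) : ℝ := ⨅ p : ℤ, |x - (p : ℝ)|

/-- The Diophantine condition CD on a real number. -/
def IsCD (α : ℝ) : Prop :=
  Irrational α ∧ ∃ c : ℝ, 0 < c ∧ ∃ τ : ℝ, 0 ≤ τ ∧
    ∀ N : ℕ, 1 ≤ N → c / (N : ℝ) ^ (1 + τ) ≤ distInt (N * α)

/-- The Diophantine condition CD₁ on a pair of real numbers. -/
def IsCD1 (α β : ℝ) : Prop :=
  Irrational α ∧ ∃ c : ℝ, 0 < c ∧ ∃ τ : ℝ, 0 ≤ τ ∧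
    (∀ N : ℕ, 1 ≤ N → c / (N : ℝ) ^ (1 + τ) ≤ distInt (N * α)) ∧
    (∀ N : ℤ, N ≠ 0 → c / |(N : ℝ)| ^ (1 + τ) ≤ distInt (N * α - β))

/-- The C^r norm of a smooth Banach-space-valued function on the circle. -/
def cNorm {E : Type*} [NormedAddCommGroup E] [NormedSpace ℝ E] (r : ℕ) (g : ℝ → E) : ℝ :=
  ∑ i ∈ Finset.range (r + 1), ⨆ θ : ℝ, ‖iteratedDeriv i g θ‖

/-- C^∞ and ℤ-periodic : a smooth function on the circle 𝕋¹ = ℝ/ℤ. -/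
def SmoothPer {E : Type*} [NormedAddCommGroup E] [NormedSpace ℝ E] (g : ℝ → E) : Prop :=
  ContDiff ℝ (⊤ : ℕ∞) g ∧ Function.Periodic g 1

/-- Fourier coefficients of a function on the circle. -/
def fourierCoef (φ : ℝ → ℂ) (n : ℤ) : ℂ :=
  ∫ θ in (0:ℝ)..1, φ θ * Complex.exp (-(2 * π * I * n * θ))

/-- The closed disc of radius r in ℂ. -/
abbrev OmDom (r : ℝ) : Set ℂ := Metric.closedBall (0 : ℂ) r

instance (r : ℝ) : CompactSpace (OmDom r) :=
  isCompact_iff_compactSpace.mp (isCompact_closedBall (0:ℂ) r)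

/-- The Banach space Ω(closure D(0,r)) realized as continuous functions on the closed disc
(holomorphy on the open disc is the predicate `HolOm`), with the sup norm. -/
abbrev Om (r : ℝ) := C(OmDom r, ℂ)

-- Evaluation of an element of Ω at a point of the closed disc (junk value outside).
open scoped Classical in
def evOm {r : ℝ} (g : Om r) (z : ℂ) : ℂ :=
  if h : z ∈ OmDom r then g ⟨z, h⟩ else 0

/-- Holomorphy on the open disc. -/
def HolOm {r : ℝ} (g : Om r) : Prop :=
  DifferentiableOn ℂ (evOm g) (Metric.ball (0:ℂ) r)

/-- The model fiber map z ↦ e^{2πiβ} z as an element of Ω(closure 𝔻). -/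
def lamMap (β : ℝ) : Om 1 :=
  ⟨fun z => Complex.exp (2 * π * I * β) * z.val, by fun_prop⟩

/-- `u` is a C^∞ curve with values in the open unit disc, invariant under the fibered
holomorphic dynamics F(θ,z) = (θ+α, f(θ,z)). -/
def IsInvCurve (α : ℝ) (f : ℝ → Om 1) (u : ℝ → ℂ) : Prop :=
  ContDiff ℝ (⊤ : ℕ∞) u ∧ Function.Periodic u 1 ∧ (∀ θ, ‖u θ‖ < 1) ∧
    ∀ θ, evOm (f θ) (u θ) = u (θ + α)

/-- The curve `u` has degree zero (the derivative along the curve admits a continuous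
logarithm ℓ on 𝕋¹), is indifferent (∫ log|∂_z f(θ,u(θ))| dθ = 0), and its transversal
rotation number (1/2πi)∫ ℓ is β mod 1. -/
def HasRotNum (β : ℝ) (f : ℝ → Om 1) (u : ℝ → ℂ) : Prop :=
  ∃ ℓ : ℝ → ℂ, Continuous ℓ ∧ Function.Periodic ℓ 1 ∧
    (∀ θ, Complex.exp (ℓ θ) = deriv (evOm (f θ)) (u θ)) ∧
    (∫ θ in (0:ℝ)..1, (ℓ θ).re) = 0 ∧
    ∃ m : ℤ, (∫ θ in (0:ℝ)..1, ℓ θ) = 2 * π * I * (β + m)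

/-- Smallest singular value of an ℝ-linear map ℂ → ℂ (ℂ ≅ ℝ²). -/
def minSv (A : ℂ →L[ℝ] ℂ) : ℝ := ⨅ v : Metric.sphere (0:ℂ) 1, ‖A v.val‖

end

open Filter Topology

/-- The character `θ ↦ e^{2πinθ}` of the circle. -/
noncomputable def circleChar (n : ℤ) (θ : ℝ) : ℂ := Complex.exp (2 * π * I * n * θ)

lemma norm_circleChar (n : ℤ) (θ : ℝ) : ‖circleChar n θ‖ = 1 := by
  have h : (2 * π * I * n * θ : ℂ) = ((2 * π * n * θ : ℝ) : ℂ) * I := by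
    push_cast
    ring
  rw [circleChar, h, Complex.norm_exp_ofReal_mul_I]

lemma circleChar_add (n : ℤ) (x y : ℝ) :
    circleChar n (x + y) = circleChar n x * circleChar n y := by
  rw [circleChar, circleChar, circleChar, ← Complex.exp_add]
  congr 1
  push_cast
  ring

lemma circleChar_add_left (m n : ℤ) (x : ℝ) :
    circleChar (m + n) x = circleChar m x * circleChar n x := by
  rw [circleChar, circleChar, circleChar, ← Complex.exp_add]
  congr 1
  push_cast
  ring

lemma circleChar_int (n m : ℤ) : circleChar n m = 1 := by
  rw [circleChar, Complex.exp_eq_one_iff]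
  exact ⟨n * m, by push_cast; ring⟩

lemma circleChar_zero_left (x : ℝ) : circleChar 0 x = 1 := by
  simp [circleChar]

lemma circleChar_zero_right (n : ℤ) : circleChar n 0 = 1 := by
  simp [circleChar]

lemma periodic_circleChar (n : ℤ) : Function.Periodic (circleChar n) 1 := fun x => by
  have h := circleChar_int n 1
  rw [Int.cast_one] at h
  rw [circleChar_add, h, mul_one]

lemma circleChar_neg_eq (n : ℤ) (x : ℝ) :
    circleChar (-n) x = Complex.exp (-(2 * π * I * n * x)) := by
  rw [circleChar]
  congr 1
  push_cast
  ring

lemma circleChar_mul_neg (n : ℤ) (x : ℝ) : circleChar n x * circleChar (-n) x = 1 := by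
  rw [← circleChar_add_left, add_neg_cancel, circleChar_zero_left]

lemma contDiff_circleChar (n : ℤ) (k : WithTop ℕ∞) : ContDiff ℝ k (circleChar n) :=
  (contDiff_const.mul Complex.ofRealCLM.contDiff).cexp

lemma hasDerivAt_circleChar (n : ℤ) (x : ℝ) :
    HasDerivAt (circleChar n) (2 * π * I * n * circleChar n x) x := by
  have h : HasDerivAt (fun y : ℝ => (2 * π * I * n * y : ℂ)) (2 * π * I * n) x := by
    simpa using (Complex.ofRealCLM.hasDerivAt (x := x)).const_mul (2 * π * I * n : ℂ)
  rw [mul_comm]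
  exact h.cexp

lemma iteratedDeriv_circleChar (k : ℕ) (n : ℤ) :
    iteratedDeriv k (circleChar n) = fun x => (2 * π * I * n : ℂ) ^ k * circleChar n x := by
  induction k with
  | zero => simp
  | succ k ih =>
    rw [iteratedDeriv_succ, ih]
    ext x
    rw [((hasDerivAt_circleChar n x).const_mul _).deriv]
    ring

lemma integral_circleChar (n : ℤ) :
    ∫ θ in (0:ℝ)..1, circleChar n θ = if n = 0 then 1 else 0 := by
  split_ifs with h
  · simp [h, circleChar_zero_left]
  · have hc : (2 * π * I * n : ℂ) ≠ 0 :=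
      mul_ne_zero Complex.two_pi_I_ne_zero (Int.cast_ne_zero.mpr h)
    have h1 := circleChar_int n 1
    rw [Int.cast_one] at h1
    have h0 : ∫ θ in (0:ℝ)..1, 2 * π * I * n * circleChar n θ = 0 := by
      rw [intervalIntegral.integral_eq_sub_of_hasDerivAt
        (fun x _ => hasDerivAt_circleChar n x)
        ((continuous_const.mul (contDiff_circleChar n 0).continuous).intervalIntegrable _ _),
        h1, circleChar_zero_right, sub_self]
    rw [intervalIntegral.integral_const_mul] at h0
    exact (mul_eq_zero.mp h0).resolve_left hc

lemma fourierCoef_eq_integral_circleChar (φ : ℝ → ℂ) (n : ℤ) :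
    fourierCoef φ n = ∫ θ in (0:ℝ)..1, φ θ * circleChar (-n) θ := by
  simp only [fourierCoef, circleChar_neg_eq]

/-- Translation multiplies the `n`-th Fourier coefficient by `e^{2πinα}`. -/
lemma fourierCoef_comp_add {u : ℝ → ℂ} (hu : Function.Periodic u 1) (α : ℝ) (n : ℤ) :
    fourierCoef (fun θ => u (θ + α)) n = circleChar n α * fourierCoef u n := by
  have hp : Function.Periodic (fun θ => u θ * circleChar (-n) θ) 1 :=
    hu.mul (periodic_circleChar (-n))
  have hint := hp.intervalIntegral_add_eq α 0
  rw [zero_add] at hint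
  rw [fourierCoef_eq_integral_circleChar, fourierCoef_eq_integral_circleChar, ← hint,
    ← intervalIntegral.integral_const_mul]
  have hshift := intervalIntegral.integral_comp_add_right (a := 0) (b := 1)
    (fun θ => circleChar n α * (u θ * circleChar (-n) θ)) α
  rw [zero_add, add_comm 1 α] at hshift
  rw [← hshift]
  congr 1
  ext θ
  rw [circleChar_add]
  linear_combination (-(u (θ + α) * circleChar (-n) θ)) * circleChar_mul_neg n α

/-- Fourier coefficients of a solution of the cohomological equation
`a θ + lam * u θ = u (θ + α)`. -/
lemma fourierCoef_of_cohomological {a u : ℝ → ℂ} {α : ℝ} {lam : ℂ} (ha : Continuous a)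
    (hu : Continuous u) (hup : Function.Periodic u 1)
    (h : ∀ θ, a θ + lam * u θ = u (θ + α)) (n : ℤ) :
    fourierCoef a n = (circleChar n α - lam) * fourierCoef u n := by
  have hc := (contDiff_circleChar (-n) 0).continuous
  have key : fourierCoef (fun θ => u (θ + α)) n = fourierCoef a n + lam * fourierCoef u n := by
    simp only [fourierCoef_eq_integral_circleChar]
    have hi₁ : IntervalIntegrable (fun θ => a θ * circleChar (-n) θ) volume 0 1 :=
      (ha.mul hc).intervalIntegrable _ _
    have hi₂ : IntervalIntegrable (fun θ => lam * (u θ * circleChar (-n) θ)) volume 0 1 :=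
      (continuous_const.mul (hu.mul hc)).intervalIntegrable _ _
    rw [← intervalIntegral.integral_const_mul, ← intervalIntegral.integral_add hi₁ hi₂]
    congr 1
    ext θ
    rw [← h]
    ring
  rw [fourierCoef_comp_add hup] at key
  linear_combination -key

/-- The Riemann–Lebesgue lemma for Fourier coefficients. -/
lemma tendsto_fourierCoef_cofinite (u : ℝ → ℂ) :
    Tendsto (fourierCoef u) cofinite (𝓝 0) := by
  have h := (Real.tendsto_integral_exp_smul_cocompact ((Ioc (0:ℝ) 1).indicator u)).comp
    Int.tendsto_coe_cofinite
  refine h.congr fun n => ?_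
  rw [fourierCoef, intervalIntegral.integral_of_le zero_le_one,
    ← integral_indicator measurableSet_Ioc]
  refine integral_congr_ae (Eventually.of_forall fun v => ?_)
  by_cases hv : v ∈ Ioc (0:ℝ) 1
  · simp only [hv, indicator_of_mem, Circle.smul_def, Real.fourierChar_apply, smul_eq_mul]
    rw [mul_comm]
    congr 2
    push_cast
    ring
  · simp [hv]

/-- A trigonometric series with rapidly decreasing coefficients is smooth and periodic. -/
lemma smoothPer_tsum_circleChar {ι : Type*} (N : ι → ℤ) (c : ι → ℂ)
    (h : ∀ k : ℕ, Summable fun i => |(N i : ℝ)| ^ k * ‖c i‖) :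
    SmoothPer fun θ => ∑' i, c i * circleChar (N i) θ := by
  refine ⟨?_, fun θ => by simp only [periodic_circleChar _ θ]⟩
  refine contDiff_tsum (v := fun k i => (2 * π) ^ k * (|(N i : ℝ)| ^ k * ‖c i‖))
    (fun i => contDiff_const.mul (contDiff_circleChar _ _)) (fun k _ => (h k).mul_left _) ?_
  intro k i x _
  rw [norm_iteratedFDeriv_eq_norm_iteratedDeriv, iteratedDeriv_const_mul_field,
    iteratedDeriv_circleChar]
  simp only [norm_mul, norm_pow, norm_circleChar, Complex.norm_I, Complex.norm_real,
    Complex.norm_intCast, Complex.norm_ofNat, Real.norm_eq_abs, abs_of_pos Real.pi_pos]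
  apply le_of_eq
  ring

/-- The Fourier coefficients of an absolutely convergent trigonometric series with distinct
frequencies are its coefficients. -/
lemma fourierCoef_tsum_circleChar {ι : Type*} [Countable ι] {N : ι → ℤ}
    (hN : Function.Injective N) {c : ι → ℂ} (h : Summable fun i => ‖c i‖) (j : ι) :
    fourierCoef (fun θ => ∑' i, c i * circleChar (N i) θ) (N j) = c j := by
  classical
  have hcont : ∀ i, Continuous fun θ => c i * circleChar (N i - N j) θ := fun i =>
    continuous_const.mul (contDiff_circleChar _ 0).continuous
  have hnorm : ∀ i, ∫ θ in Ioc (0:ℝ) 1, ‖c i * circleChar (N i - N j) θ‖ = ‖c i‖ := fun i => by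
    simp [norm_circleChar]
  have key := integral_tsum_of_summable_integral_norm (μ := volume.restrict (Ioc (0:ℝ) 1))
    (F := fun i θ => c i * circleChar (N i - N j) θ)
    (fun i => ((hcont i).intervalIntegrable 0 1).1) (by simpa only [hnorm] using h)
  rw [fourierCoef_eq_integral_circleChar, intervalIntegral.integral_of_le zero_le_one]
  have hfun : ∀ θ, (∑' i, c i * circleChar (N i) θ) * circleChar (-N j) θ =
      ∑' i, c i * circleChar (N i - N j) θ := fun θ => by
    rw [← tsum_mul_right]
    congr 1
    ext i
    rw [sub_eq_add_neg, circleChar_add_left, mul_assoc]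
  simp only [hfun]
  rw [← key]
  have hterm : ∀ i, ∫ θ in Ioc (0:ℝ) 1, c i * circleChar (N i - N j) θ =
      if i = j then c j else 0 := fun i => by
    rw [← intervalIntegral.integral_of_le zero_le_one, intervalIntegral.integral_const_mul,
      integral_circleChar]
    by_cases hij : i = j
    · simp [hij]
    · simp [hij, sub_eq_zero, hN.ne hij]
  simp only [hterm, tsum_ite_eq]

lemma norm_circleChar_sub_exp_le (n : ℤ) (α β : ℝ) :
    ‖circleChar n α - Complex.exp (2 * π * I * β)‖ ≤ 2 * π * distInt (n * α - β) := by
  rw [← div_le_iff₀' Real.two_pi_pos]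
  refine le_ciInf fun p => ?_
  rw [div_le_iff₀' Real.two_pi_pos]
  have hfac : circleChar n α - Complex.exp (2 * π * I * β) = Complex.exp (2 * π * I * β) *
      (Complex.exp (I * (2 * π * (n * α - β - p) : ℝ)) - 1) := by
    rw [mul_sub, ← Complex.exp_add, mul_one, circleChar]
    congr 1
    rw [Complex.exp_eq_exp_iff_exists_int]
    exact ⟨p, by push_cast; ring⟩
  have hβ : ‖Complex.exp (2 * π * I * β)‖ = 1 := by
    simpa [circleChar] using norm_circleChar 1 β
  rw [hfac, norm_mul, hβ, one_mul]
  refine Real.norm_exp_I_mul_ofReal_sub_one_le.trans_eq ?_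
  rw [Real.norm_eq_abs, abs_mul, abs_of_pos Real.two_pi_pos]

/-- If `α` is Diophantine and the pair `(α, β)` is not `CD₁`, then the small divisors
`e^{2πiNα} - e^{2πiβ}` are super-polynomially small along some sequence of frequencies. -/
lemma exists_small_divisors {α β : ℝ} (hα : IsCD α) (hβ : ¬ IsCD1 α β) :
    ∃ N : ℕ → ℤ, ∀ k, |(N k : ℝ)| ^ k * ‖circleChar (N k) α - Complex.exp (2 * π * I * β)‖
      ≤ 2 * π * (1 / 2) ^ k ∧ N k ≠ 0 := by
  obtain ⟨hirr, c, hc, τ, hτ, hcd⟩ := hα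
  have hex : ∀ k : ℕ, ∃ n : ℤ, n ≠ 0 ∧
      distInt (n * α - β) < min c ((1 / 2) ^ k) / |(n : ℝ)| ^ (1 + max τ k) := by
    intro k
    by_contra! hcon
    refine hβ ⟨hirr, min c ((1 / 2) ^ k), lt_min hc (by positivity), max τ k,
      hτ.trans (le_max_left _ _), fun n hn => le_trans ?_ (hcd n hn), hcon⟩
    have hn' : (1 : ℝ) ≤ n := by exact_mod_cast hn
    gcongr
    · exact min_le_left _ _
    · exact le_max_left _ _
  choose N hN0 hN using hex
  refine ⟨N, fun k => ⟨?_, hN0 k⟩⟩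
  have h1 : (1 : ℝ) ≤ |(N k : ℝ)| := by exact_mod_cast Int.one_le_abs (hN0 k)
  have hpos : 0 < |(N k : ℝ)| := by linarith
  have hle : |(N k : ℝ)| ^ k ≤ |(N k : ℝ)| ^ (1 + max τ k) := by
    rw [← Real.rpow_natCast]
    refine Real.rpow_le_rpow_of_exponent_le h1 ?_
    linarith [le_max_right τ (k : ℝ)]
  have hd := (lt_div_iff₀ (Real.rpow_pos_of_pos hpos _)).mp (hN k)
  have hnn : 0 ≤ distInt (N k * α - β) := Real.iInf_nonneg fun _ => abs_nonneg _
  calc |(N k : ℝ)| ^ k * ‖circleChar (N k) α - Complex.exp (2 * π * I * β)‖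
      ≤ |(N k : ℝ)| ^ (1 + max τ k) * (2 * π * distInt (N k * α - β)) := by
        gcongr
        exact norm_circleChar_sub_exp_le _ _ _
    _ = 2 * π * (distInt (N k * α - β) * |(N k : ℝ)| ^ (1 + max τ k)) := by ring
    _ ≤ 2 * π * (1 / 2) ^ k := by
        gcongr
        exact hd.le.trans (min_le_right _ _)

/-- In the absence of an exact resonance, a sequence with super-polynomially small divisors takes
infinitely many values. -/
lemma infinite_range_of_small_divisors {α : ℝ} {lam : ℂ} {N : ℕ → ℤ} {C : ℝ}
    (hN : ∀ k, |(N k : ℝ)| ^ k * ‖circleChar (N k) α - lam‖ ≤ C * (1 / 2) ^ k ∧ N k ≠ 0)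
    (hres : ∀ n, circleChar n α - lam ≠ 0) : (range N).Infinite := by
  intro hfin
  obtain ⟨m, -, hm⟩ := exists_min_image (range N) (fun n => ‖circleChar n α - lam‖) hfin
    (range_nonempty N)
  have hpos : 0 < ‖circleChar m α - lam‖ := norm_pos_iff.mpr (hres m)
  have hlim : Tendsto (fun k : ℕ => C * (1 / 2 : ℝ) ^ k) atTop (𝓝 (C * 0)) :=
    (tendsto_pow_atTop_nhds_zero_of_lt_one (by norm_num) (by norm_num)).const_mul _
  rw [mul_zero] at hlim
  obtain ⟨k, hk⟩ := (hlim.eventually_lt_const hpos).exists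
  have h1 : (1 : ℝ) ≤ |(N k : ℝ)| := by exact_mod_cast Int.one_le_abs (hN k).2
  have h2 := le_mul_of_one_le_left (norm_nonneg (circleChar (N k) α - lam)) (one_le_pow₀ h1 (n := k))
  linarith [(hN k).1, hm (N k) (mem_range_self k)]

lemma summable_pow_mul_small_divisors {α : ℝ} {lam : ℂ} {N : ℕ → ℤ} {C : ℝ}
    (hN : ∀ k, |(N k : ℝ)| ^ k * ‖circleChar (N k) α - lam‖ ≤ C * (1 / 2) ^ k ∧ N k ≠ 0)
    (r : ℕ) : Summable fun k => |(N k : ℝ)| ^ r * ‖circleChar (N k) α - lam‖ := by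
  refine Summable.of_norm_bounded_eventually_nat (g := fun k => C * (1 / 2 : ℝ) ^ k)
    ((summable_geometric_of_lt_one (by norm_num) (by norm_num)).mul_left C) ?_
  filter_upwards [eventually_ge_atTop r] with k hk
  have h1 : (1 : ℝ) ≤ |(N k : ℝ)| := by exact_mod_cast Int.one_le_abs (hN k).2
  rw [Real.norm_of_nonneg (by positivity)]
  refine le_trans ?_ (hN k).1
  gcongr

/-- If `α` is Diophantine and `(α, β)` is not `CD₁`, some smooth function is not a twisted
coboundary over the rotation by `α`. -/
lemma exists_smoothPer_not_coboundary {α β : ℝ} (hα : IsCD α) (hβ : ¬ IsCD1 α β) :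
    ∃ a : ℝ → ℂ, SmoothPer a ∧ ∀ u : ℝ → ℂ, SmoothPer u →
      ¬ ∀ θ, a θ + Complex.exp (2 * π * I * β) * u θ = u (θ + α) := by
  set lam : ℂ := Complex.exp (2 * π * I * β) with hlam
  by_cases hres : ∃ n, circleChar n α - lam = 0
  · obtain ⟨n, hn⟩ := hres
    refine ⟨circleChar n, ⟨contDiff_circleChar _ _, periodic_circleChar n⟩, fun u hu h => ?_⟩
    have hf := fourierCoef_of_cohomological (contDiff_circleChar n 0).continuous
      hu.1.continuous hu.2 h n
    rw [hn, zero_mul, fourierCoef_eq_integral_circleChar] at hf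
    simp [circleChar_mul_neg] at hf
  · push Not at hres
    obtain ⟨N, hN⟩ := exists_small_divisors hα hβ
    rw [← hlam] at hN
    have hinf := infinite_range_of_small_divisors hN hres
    have hsum : ∀ r : ℕ, Summable fun n : range N =>
        |((n : ℤ) : ℝ)| ^ r * ‖circleChar n α - lam‖ := fun r => by
      have hs := (summable_pow_mul_small_divisors hN r).comp_injective
        (rangeSplitting_injective N)
      simpa only [Function.comp_def, apply_rangeSplitting] using hs
    have hsmooth := smoothPer_tsum_circleChar (fun n : range N => (n : ℤ))
      (fun n => circleChar n α - lam) hsum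
    refine ⟨_, hsmooth, fun u hu h => ?_⟩
    have hcoef : ∀ n ∈ range N, fourierCoef u n = 1 := fun n hn => by
      have hf := fourierCoef_of_cohomological hsmooth.1.continuous hu.1.continuous hu.2 h n
      have hsum0 : Summable fun n : range N => ‖circleChar n α - lam‖ := by
        simpa using hsum 0
      have hn' := fourierCoef_tsum_circleChar (Subtype.val_injective (p := (· ∈ range N)))
        hsum0 ⟨n, hn⟩
      rw [hn'] at hf
      exact (mul_right_eq_self₀.mp hf.symm).resolve_right (hres n)
    have hev := (tendsto_fourierCoef_cofinite u).eventually_ne (zero_ne_one (α := ℂ))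
    exact hinf ((eventually_cofinite.mp hev).subset fun n hn => by simpa using hcoef n hn)

lemma cNorm_ofReal_mul {r : ℕ} {δ : ℝ} (hδ : 0 ≤ δ) (a : ℝ → ℂ) :
    cNorm r (fun θ => (δ : ℂ) * a θ) = δ * cNorm r a := by
  simp only [cNorm, Finset.mul_sum, iteratedDeriv_const_mul_field, norm_mul, Complex.norm_real,
    Real.norm_of_nonneg hδ, Real.mul_iSup_of_nonneg hδ]

/-- optimality of the Diophantine condition. If α ∈ CD but (α,β) ∉ CD₁, there
are arbitrarily small smooth functions a such that no map F_t(θ,z) = (θ+α, t·a(θ) + t·λz)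
of the one-parameter family admits a C^∞ invariant curve (of degree zero) with transversal
rotation number β; the rotation-number constraint on the constant derivative t·λ reads
t·e^{2πiβ} = e^{2πi(β+m)} for some integer m. -/
theorem no_invariant_curve_without_CD1
    (α β : ℝ) (hα : IsCD α) (hβ : ¬ IsCD1 α β) :
    ∀ ε : ℝ, 0 < ε → ∀ r : ℕ,
      ∃ a : ℝ → ℂ, SmoothPer a ∧ cNorm r a < ε ∧
        ∀ t : ℂ, ∀ u : ℝ → ℂ, SmoothPer u →
          (∀ θ : ℝ, t * a θ + t * Complex.exp (2 * π * I * β) * u θ = u (θ + α)) →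
          (∃ m : ℤ, t * Complex.exp (2 * π * I * β) = Complex.exp (2 * π * I * (β + m))) →
          False := by
  intro ε hε r
  obtain ⟨a, ha, hne⟩ := exists_smoothPer_not_coboundary hα hβ
  have hnn : 0 ≤ cNorm r a :=
    Finset.sum_nonneg fun _ _ => Real.iSup_nonneg fun _ => norm_nonneg _
  set δ : ℝ := ε / (cNorm r a + 1) with hδ
  have hδpos : 0 < δ := by positivity
  have hδ0 : (δ : ℂ) ≠ 0 := Complex.ofReal_ne_zero.mpr hδpos.ne'
  refine ⟨fun θ => (δ : ℂ) * a θ, ⟨contDiff_const.mul ha.1, fun θ => by simp only [ha.2 θ]⟩,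
    ?_, fun t u hu h ht => ?_⟩
  · rw [cNorm_ofReal_mul hδpos.le, hδ, div_mul_eq_mul_div, div_lt_iff₀ (by positivity)]
    nlinarith
  · obtain ⟨m, hm⟩ := ht
    have ht1 : t = 1 := by
      have hper : Complex.exp (2 * π * I * (β + m)) = Complex.exp (2 * π * I * β) := by
        rw [Complex.exp_eq_exp_iff_exists_int]
        exact ⟨m, by ring⟩
      rw [hper] at hm
      exact (mul_eq_right₀ (Complex.exp_ne_zero _)).mp hm
    refine hne (fun θ => (δ : ℂ)⁻¹ * u θ)
      ⟨contDiff_const.mul hu.1, fun θ => by simp only [hu.2 θ]⟩ fun θ => ?_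
    have hθ := h θ
    simp only [ht1, one_mul] at hθ
    rw [← hθ]
    field_simp
end

section
/- Let α be an irrational number satisfying a Diophantine condition (α ∈ CD) and let φ : 𝕋¹ → ℂ be a C^∞ function with zero mean ∫_{𝕋¹} φ(θ)dθ = 0. Then the series ψ(θ) = Σ_{n∈ℤ∖{0}} φ̂(n)/(e^{2πinα}−1) · e^{2πinθ}, where φ̂(n) = ∫_{𝕋¹} φ(θ)e^{−2πinθ}dθ, converges to a C^∞ function ψ : 𝕋¹ → ℂ with zero mean which solves the cohomological equation ψ(θ+α) − ψ(θ) = φ(θ) for all θ ∈ 𝕋¹. -/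
open MeasureTheory Metric Complex Real Set Function

theorem hasDerivAt_cexp_mul_ofReal (c : ℂ) (x : ℝ) :
    HasDerivAt (fun θ : ℝ => Complex.exp (c * θ)) (c * Complex.exp (c * x)) x := by
  have h : HasDerivAt (fun z : ℂ => Complex.exp (c * z)) (c * Complex.exp (c * x)) (x : ℂ) := by
    simpa [mul_comm] using ((hasDerivAt_id (x : ℂ)).const_mul c).cexp
  exact h.comp_ofReal

theorem iteratedDeriv_cexp_mul_ofReal (c : ℂ) (k : ℕ) :
    iteratedDeriv k (fun θ : ℝ => Complex.exp (c * θ)) =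
      fun θ : ℝ => c ^ k * Complex.exp (c * θ) := by
  induction k with
  | zero => simp
  | succ k ih =>
    rw [iteratedDeriv_succ, ih]
    ext θ
    rw [((hasDerivAt_cexp_mul_ofReal c θ).const_mul (c ^ k)).deriv, pow_succ, mul_assoc]

theorem norm_cexp_two_pi_I_int_mul (n : ℤ) (θ : ℝ) :
    ‖Complex.exp (2 * π * I * n * θ)‖ = 1 := by
  have h : (2 * π * I * n * θ : ℂ) = ((2 * π * n * θ : ℝ) : ℂ) * I := by
    push_cast; ring
  rw [h, Complex.norm_exp_ofReal_mul_I]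

theorem cexp_two_pi_I_int_mul_add_one (n : ℤ) (θ : ℝ) :
    Complex.exp (2 * π * I * n * ((θ + 1 : ℝ) : ℂ)) = Complex.exp (2 * π * I * n * θ) := by
  have h : (2 * π * I * n * ((θ + 1 : ℝ) : ℂ) : ℂ) = 2 * π * I * n * θ + n * (2 * π * I) := by
    push_cast; ring
  rw [h, Complex.exp_add, Complex.exp_int_mul_two_pi_mul_I, mul_one]

theorem integral_cexp_two_pi_I_int_mul {n : ℤ} (hn : n ≠ 0) :
    ∫ θ in (0 : ℝ)..1, Complex.exp (2 * π * I * n * θ) = 0 := by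
  have hc : (2 * π * I * n : ℂ) ≠ 0 := by simp [hn, Real.pi_ne_zero]
  have h := integral_exp_mul_complex (a := 0) (b := 1) hc
  rw [h]
  have h1 := cexp_two_pi_I_int_mul_add_one n 0
  simp only [zero_add] at h1
  rw [h1]
  simp

theorem distInt_le_abs_sub (x : ℝ) (p : ℤ) : distInt x ≤ |x - p| :=
  ciInf_le ⟨0, by rintro _ ⟨q, rfl⟩; exact abs_nonneg _⟩ p

theorem distInt_neg (x : ℝ) : distInt (-x) = distInt x := by
  unfold distInt
  rw [← (Equiv.neg ℤ).iInf_comp]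
  congr 1
  ext p
  rw [← abs_neg]
  congr 1
  rw [Equiv.neg_apply, Int.cast_neg]
  ring

theorem four_mul_distInt_le (x : ℝ) :
    4 * distInt x ≤ ‖Complex.exp (2 * π * I * x) - 1‖ := by
  set y : ℝ := x - round x with hy
  have hexp : Complex.exp (2 * π * I * x) = Complex.exp (I * ((2 * π * y : ℝ) : ℂ)) := by
    have : (2 * π * I * x : ℂ) = I * ((2 * π * y : ℝ) : ℂ) + (round x : ℤ) * (2 * π * I) := by
      rw [hy]; push_cast; ring
    rw [this, Complex.exp_add, Complex.exp_int_mul_two_pi_mul_I, mul_one]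
  have hyabs : |y| ≤ 1 / 2 := abs_sub_round x
  have hsin := Real.mul_abs_le_abs_sin (x := π * y) (by
    rw [abs_mul, abs_of_pos Real.pi_pos]; nlinarith [Real.pi_pos])
  rw [abs_mul, abs_of_pos Real.pi_pos, ← mul_assoc, div_mul_cancel₀ _ Real.pi_ne_zero] at hsin
  rw [hexp, Complex.norm_exp_I_mul_ofReal_sub_one, show 2 * π * y / 2 = π * y by ring,
    norm_mul, Real.norm_eq_abs, Real.norm_eq_abs, abs_of_pos (two_pos : (0 : ℝ) < 2)]
  have := distInt_le_abs_sub x (round x)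
  rw [← hy] at this
  linarith

theorem IsCD.exists_le_norm_cexp_sub_one {α : ℝ} (hα : IsCD α) :
    ∃ c : ℝ, 0 < c ∧ ∃ m : ℕ, ∀ n : ℤ, n ≠ 0 →
      c / |(n : ℝ)| ^ m ≤ ‖Complex.exp (2 * π * I * n * α) - 1‖ := by
  obtain ⟨-, c, hc, τ, -, h⟩ := hα
  refine ⟨c, hc, ⌈1 + τ⌉₊, fun n hn => ?_⟩
  have hN : 1 ≤ n.natAbs := Int.natAbs_pos.mpr hn
  have hcast : ((n.natAbs : ℕ) : ℝ) = |(n : ℝ)| := by rw [Nat.cast_natAbs, Int.cast_abs]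
  have h1 := h n.natAbs hN
  have hN' : (1 : ℝ) ≤ |(n : ℝ)| := by rw [← hcast]; exact_mod_cast hN
  rw [hcast] at h1
  have hdist : distInt (|(n : ℝ)| * α) = distInt (n * α) := by
    rcases abs_choice (n : ℝ) with h | h
    · rw [h]
    · rw [h, neg_mul, distInt_neg]
  rw [hdist] at h1
  have h2 := four_mul_distInt_le (n * α)
  have hpow : |(n : ℝ)| ^ (1 + τ) ≤ |(n : ℝ)| ^ ⌈1 + τ⌉₊ := by
    rw [← Real.rpow_natCast]
    exact Real.rpow_le_rpow_of_exponent_le hN' (Nat.le_ceil _)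
  have hpos : 0 < |(n : ℝ)| ^ (1 + τ) := Real.rpow_pos_of_pos (by linarith) _
  have h3 : c / |(n : ℝ)| ^ ⌈1 + τ⌉₊ ≤ c / |(n : ℝ)| ^ (1 + τ) := by gcongr
  have h4 : 0 < c / |(n : ℝ)| ^ (1 + τ) := by positivity
  push_cast at h2
  rw [← mul_assoc] at h2
  linarith

theorem SmoothPer.deriv {g : ℝ → ℂ} (hg : SmoothPer g) : SmoothPer (deriv g) := by
  refine ⟨(contDiff_infty_iff_deriv.mp hg.1).2, fun x => ?_⟩
  rw [← deriv_comp_add_const]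
  exact congrArg (fun f : ℝ → ℂ => _root_.deriv f x) (funext hg.2)

theorem SmoothPer.iteratedDeriv {g : ℝ → ℂ} (hg : SmoothPer g) (k : ℕ) :
    SmoothPer (iteratedDeriv k g) := by
  induction k with
  | zero => simpa using hg
  | succ k ih => rw [iteratedDeriv_succ]; exact ih.deriv

theorem fourierCoef_deriv {g : ℝ → ℂ} (hg : SmoothPer g) (n : ℤ) :
    fourierCoef (deriv g) n = 2 * π * I * n * fourierCoef g n := by
  set c : ℂ := -(2 * π * I * n) with hc
  have hcoef (f : ℝ → ℂ) : fourierCoef f n = ∫ θ in (0 : ℝ)..1, Complex.exp (c * θ) * f θ := by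
    unfold fourierCoef
    congr 1
    ext θ
    rw [hc, neg_mul, mul_comm]
  have hparts := intervalIntegral.integral_mul_deriv_eq_deriv_mul (a := 0) (b := 1)
    (u := fun θ : ℝ => Complex.exp (c * θ)) (v := g)
    (fun x _ => hasDerivAt_cexp_mul_ofReal c x)
    (fun x _ => ((contDiff_infty_iff_deriv.mp hg.1).1 x).hasDerivAt)
    (by apply Continuous.intervalIntegrable; fun_prop)
    (hg.deriv.1.continuous.intervalIntegrable _ _)
  rw [hcoef, hcoef, hparts]
  have hg1 : g 1 = g 0 := by simpa using hg.2 0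
  have he : Complex.exp (c * (1 : ℝ)) = 1 := by
    have := Complex.exp_int_mul_two_pi_mul_I (-n)
    rw [← this, hc]
    congr 1
    push_cast; ring
  simp_rw [he, hg1, mul_assoc c]
  rw [intervalIntegral.integral_const_mul, hc]
  simp

theorem fourierCoef_iteratedDeriv {g : ℝ → ℂ} (hg : SmoothPer g) (n : ℤ) (k : ℕ) :
    fourierCoef (iteratedDeriv k g) n = (2 * π * I * n) ^ k * fourierCoef g n := by
  induction k with
  | zero => simp
  | succ k ih =>
    rw [iteratedDeriv_succ, fourierCoef_deriv (hg.iteratedDeriv k), ih, pow_succ]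
    ring

theorem norm_fourierCoef_le (g : ℝ → ℂ) (n : ℤ) :
    ‖fourierCoef g n‖ ≤ ∫ θ in (0 : ℝ)..1, ‖g θ‖ := by
  refine (intervalIntegral.norm_integral_le_integral_norm zero_le_one).trans_eq ?_
  congr 1
  ext θ
  rw [norm_mul, Complex.exp_neg, norm_inv, norm_cexp_two_pi_I_int_mul, inv_one, mul_one]

theorem SmoothPer.exists_pow_mul_norm_fourierCoef_le {g : ℝ → ℂ} (hg : SmoothPer g) (k : ℕ) :
    ∃ C : ℝ, ∀ n : ℤ, |(n : ℝ)| ^ k * ‖fourierCoef g n‖ ≤ C := by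
  refine ⟨∫ θ in (0 : ℝ)..1, ‖_root_.iteratedDeriv k g θ‖, fun n => ?_⟩
  refine le_trans ?_ (norm_fourierCoef_le (_root_.iteratedDeriv k g) n)
  rw [fourierCoef_iteratedDeriv hg, norm_mul, norm_pow]
  gcongr
  simp only [norm_mul, Complex.norm_I, Complex.norm_intCast, Complex.norm_real, mul_one,
    Complex.norm_ofNat, Real.norm_eq_abs, abs_of_pos Real.pi_pos]
  nlinarith [Real.pi_gt_three, abs_nonneg (n : ℝ)]

theorem summable_pow_mul_norm_of_rapid_decay {a : ℤ → ℂ}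
    (ha : ∀ k : ℕ, ∃ C : ℝ, ∀ n : ℤ, |(n : ℝ)| ^ k * ‖a n‖ ≤ C) (k : ℕ) :
    Summable fun n : ℤ => |(n : ℝ)| ^ k * ‖a n‖ := by
  obtain ⟨C, hC⟩ := ha (k + 2)
  have hs : Summable fun n : ℤ => C * (1 / (n : ℝ) ^ 2) :=
    (Real.summable_one_div_int_pow.mpr one_lt_two).mul_left C
  refine Summable.of_norm_bounded_eventually hs ?_
  filter_upwards [(Set.finite_singleton (0 : ℤ)).compl_mem_cofinite] with n hn
  have hn0 : n ≠ 0 := hn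
  have hn' : (0 : ℝ) < (n : ℝ) ^ 2 := by positivity
  rw [Real.norm_of_nonneg (by positivity), mul_one_div, le_div_iff₀ hn']
  calc _ = |(n : ℝ)| ^ (k + 2) * ‖a n‖ := by rw [pow_add, sq_abs]; ring
    _ ≤ C := hC n

/-- A trigonometric series with summable coefficients converges absolutely. -/
theorem summable_fourier_series {a : ℤ → ℂ} (ha : Summable fun n => ‖a n‖) (θ : ℝ) :
    Summable fun n : ℤ => a n * Complex.exp (2 * π * I * n * θ) :=
  Summable.of_norm_bounded ha fun n => by
    rw [norm_mul, norm_cexp_two_pi_I_int_mul, mul_one]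

theorem smoothPer_tsum {a : ℤ → ℂ}
    (ha : ∀ k : ℕ, Summable fun n : ℤ => |(n : ℝ)| ^ k * ‖a n‖) :
    SmoothPer fun θ : ℝ => ∑' n : ℤ, a n * Complex.exp (2 * π * I * n * θ) := by
  constructor
  · refine contDiff_tsum (v := fun k (n : ℤ) => (2 * π) ^ k * (|(n : ℝ)| ^ k * ‖a n‖))
      (fun n => ?_) (fun k _ => (ha k).mul_left _) (fun k n θ _ => ?_)
    · exact contDiff_const.mul (contDiff_const.mul Complex.ofRealCLM.contDiff).cexp
    · rw [norm_iteratedFDeriv_eq_norm_iteratedDeriv, iteratedDeriv_const_mul_field,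
        iteratedDeriv_cexp_mul_ofReal, norm_mul, norm_mul, norm_cexp_two_pi_I_int_mul, norm_pow]
      simp only [norm_mul, Complex.norm_I, Complex.norm_intCast, Complex.norm_real, mul_one,
        Complex.norm_ofNat, Real.norm_eq_abs, abs_of_pos Real.pi_pos]
      rw [mul_pow]
      exact (by ring : _ = _).le
  · intro θ
    simp_rw [cexp_two_pi_I_int_mul_add_one]

theorem integral_tsum_fourier_series {a : ℤ → ℂ} (ha : Summable fun n => ‖a n‖) :
    ∫ θ in (0 : ℝ)..1, ∑' n : ℤ, a n * Complex.exp (2 * π * I * n * θ) = a 0 := by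
  have h := intervalIntegral.hasSum_integral_of_dominated_convergence (μ := volume)
    (a := 0) (b := 1) (F := fun (n : ℤ) (θ : ℝ) => a n * Complex.exp (2 * π * I * n * θ))
    (f := fun θ => ∑' n : ℤ, a n * Complex.exp (2 * π * I * n * θ))
    (fun n _ => ‖a n‖)
    (fun (n : ℤ) => (by fun_prop : Continuous fun θ : ℝ =>
      a n * Complex.exp (2 * π * I * n * θ)).aestronglyMeasurable)
    (fun n => .of_forall fun θ _ => by rw [norm_mul, norm_cexp_two_pi_I_int_mul, mul_one])
    (.of_forall fun _ _ => ha)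
    intervalIntegrable_const
    (.of_forall fun θ _ => (summable_fourier_series ha θ).hasSum)
  refine h.unique ?_
  have h0 : ∫ θ in (0 : ℝ)..1, a 0 * Complex.exp (2 * π * I * (0 : ℤ) * θ) = a 0 := by simp
  rw [← h0]
  refine hasSum_single 0 fun n hn => ?_
  rw [intervalIntegral.integral_const_mul, integral_cexp_two_pi_I_int_mul hn, mul_zero]

theorem hasSum_fourierCoef {g : ℝ → ℂ} (hg : Continuous g) (hper : Function.Periodic g 1)
    (hs : Summable fun n => ‖fourierCoef g n‖) (θ : ℝ) :
    HasSum (fun n : ℤ => fourierCoef g n * Complex.exp (2 * π * I * n * θ)) (g θ) := by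
  have : Fact ((0 : ℝ) < 1) := ⟨one_pos⟩
  let f : C(AddCircle (1 : ℝ), ℂ) := ⟨hper.lift, continuous_coinduced_dom.mpr hg⟩
  have hf (x : ℝ) : f (x : AddCircle (1 : ℝ)) = g x := hper.lift_coe x
  have hcoef : fourierCoeff f = fourierCoef g := by
    ext n
    rw [fourierCoeff_eq_intervalIntegral _ n 0, fourierCoef]
    simp only [zero_add, div_one, one_smul, fourier_coe_apply, hf, smul_eq_mul]
    congr 1
    ext x
    rw [mul_comm]
    congr 2
    push_cast
    ring
  have h := has_pointwise_sum_fourier_series_of_summable (f := f)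
    (by rw [hcoef]; exact hs.of_norm) (θ : AddCircle (1 : ℝ))
  rw [hcoef, hf] at h
  simpa only [fourier_coe_apply, smul_eq_mul, Complex.ofReal_one, div_one] using h

/-- solution of the classical cohomological equation under a Diophantine
condition on α, via the Fourier series. -/
theorem cohomological_equation_solvable
    (α : ℝ) (hα : IsCD α) (φ : ℝ → ℂ) (hφ : SmoothPer φ)
    (hmean : (∫ θ in (0:ℝ)..1, φ θ) = 0) :
    ∃ ψ : ℝ → ℂ, SmoothPer ψ ∧ (∫ θ in (0:ℝ)..1, ψ θ) = 0 ∧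
      (∀ θ : ℝ, HasSum (fun n : ℤ => if n = 0 then 0 else
          fourierCoef φ n / (Complex.exp (2 * π * I * n * α) - 1)
            * Complex.exp (2 * π * I * n * θ)) (ψ θ)) ∧
      ∀ θ : ℝ, ψ (θ + α) - ψ θ = φ θ := by
  obtain ⟨c, hc, m, hm⟩ := hα.exists_le_norm_cexp_sub_one
  have hzero : fourierCoef φ 0 = 0 := by simpa [fourierCoef] using hmean
  have hlower (n : ℤ) (hn : n ≠ 0) : 0 < ‖Complex.exp (2 * π * I * n * α) - 1‖ :=
    lt_of_lt_of_le (by positivity) (hm n hn)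
  let a : ℤ → ℂ := fun n => if n = 0 then 0 else
    fourierCoef φ n / (Complex.exp (2 * π * I * n * α) - 1)
  have hdecay (k : ℕ) : ∃ C : ℝ, ∀ n : ℤ, |(n : ℝ)| ^ k * ‖a n‖ ≤ C := by
    obtain ⟨C, hC⟩ := hφ.exists_pow_mul_norm_fourierCoef_le (k + m)
    refine ⟨C / c, fun n => ?_⟩
    have hC0 : 0 ≤ C := le_trans (by positivity) (hC 0)
    by_cases hn : n = 0
    · simp only [a, if_pos hn, norm_zero, mul_zero]
      positivity
    · simp only [a, if_neg hn, norm_div]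
      have hn' : (0 : ℝ) < |(n : ℝ)| ^ m := by positivity
      have hle : c ≤ |(n : ℝ)| ^ m * ‖Complex.exp (2 * π * I * n * α) - 1‖ := by
        have := (div_le_iff₀ hn').mp (hm n hn)
        linarith
      rw [← mul_div_assoc, div_le_div_iff₀ (hlower n hn) hc]
      calc _ ≤ |(n : ℝ)| ^ k * ‖fourierCoef φ n‖ *
            (|(n : ℝ)| ^ m * ‖Complex.exp (2 * π * I * n * α) - 1‖) := by gcongr
        _ = |(n : ℝ)| ^ (k + m) * ‖fourierCoef φ n‖ *
            ‖Complex.exp (2 * π * I * n * α) - 1‖ := by rw [pow_add]; ring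
        _ ≤ _ := by gcongr; exact hC n
  have hsum := summable_pow_mul_norm_of_rapid_decay hdecay
  have hsum0 : Summable fun n => ‖a n‖ := by simpa using hsum 0
  have hφsum : Summable fun n => ‖fourierCoef φ n‖ := by
    simpa using summable_pow_mul_norm_of_rapid_decay hφ.exists_pow_mul_norm_fourierCoef_le 0
  refine ⟨_, smoothPer_tsum hsum, ?_, fun θ => ?_, fun θ => ?_⟩
  · rw [integral_tsum_fourier_series hsum0]
    exact if_pos rfl
  · have h := (summable_fourier_series hsum0 θ).hasSum
    simpa only [a, ite_mul, zero_mul] using h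
  · have h := (summable_fourier_series hsum0 (θ + α)).hasSum.sub
      (summable_fourier_series hsum0 θ).hasSum
    have hterm (n : ℤ) : a n * Complex.exp (2 * π * I * n * ((θ + α : ℝ) : ℂ)) -
        a n * Complex.exp (2 * π * I * n * θ) =
          fourierCoef φ n * Complex.exp (2 * π * I * n * θ) := by
      by_cases hn : n = 0
      · simp [a, hn, hzero]
      · have hne : Complex.exp (2 * π * I * n * α) - 1 ≠ 0 := norm_pos_iff.mp (hlower n hn)
        simp only [a, if_neg hn]
        rw [Complex.ofReal_add, mul_add, Complex.exp_add]
        field_simp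
    simp_rw [hterm] at h
    exact h.unique (hasSum_fourierCoef hφ.1.continuous hφ.2 hφsum θ)
end

section
/- Let R > 0, let D be the closed disc of radius R centered at 0 in ℝ², let G : D → ℝ² be continuous, and let J(s) = a + A·s be an affine map with a ∈ ℝ² and A : ℝ² → ℝ² an invertible linear map, such that the unique zero −A⁻¹a of J lies in the open disc of radius R. If |G(s) − J(s)| < |J(s)| for every s on the boundary circle |s| = R, then G has a zero in D: there exists s* ∈ D with G(s*) = 0. -/
open MeasureTheory Metric Complex Real Set Function

/-- A continuous nowhere vanishing complex function on a normed space has a continuous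
logarithm. -/
theorem exists_continuous_exp_eq {E : Type*} [NormedAddCommGroup E] [NormedSpace ℝ E]
    {f : E → ℂ} (hf : Continuous f) (hf0 : ∀ x, f x ≠ 0) :
    ∃ L : E → ℂ, Continuous L ∧ ∀ x, Complex.exp (L x) = f x := by
  obtain ⟨L, ⟨-, hL⟩, -⟩ := Complex.isCoveringMapOn_exp.existsUnique_continuousMap_lifts
    ⟨f, hf⟩ (a₀ := 0) (Complex.exp_log (hf0 0)) hf0
  exact ⟨L, L.continuous, congrFun hL⟩

/-- The identity of the circle, up to a positive factor, has no continuous logarithm. -/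
theorem not_exists_periodic_log {F : ℝ → ℂ} (hF : Continuous F)
    (hper : F (2 * π) = F 0) {c : ℝ → ℝ} (hc : ∀ θ, 0 < c θ)
    (h : ∀ θ, Complex.exp (F θ) = c θ * Complex.exp (θ * I)) : False := by
  have integer : ∀ θ, ∃ n : ℤ, (F θ).im = θ + n * (2 * π) := fun θ ↦ by
    have := h θ
    rw [← Complex.exp_log (Complex.ofReal_ne_zero.2 (hc θ).ne'), ← Complex.exp_add,
      Complex.exp_eq_exp_iff_exists_int] at this
    obtain ⟨n, hn⟩ := this
    refine ⟨n, ?_⟩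
    rw [hn, ← Complex.ofReal_log (hc θ).le]
    simp
  obtain ⟨n, hn⟩ := integer 0
  have hcont : Continuous fun θ ↦ (F θ).im - θ := by fun_prop
  have hivt := intermediate_value_Icc' (by positivity : (0 : ℝ) ≤ 2 * π) hcont.continuousOn
  obtain ⟨θ, -, hθ⟩ := hivt (show (F 0).im - π ∈ _ by
    rw [hper]; constructor <;> linarith [Real.pi_pos])
  obtain ⟨m, hm⟩ := integer θ
  have hnm : π * (2 * m + 1) = π * (2 * n) := by linarith
  have hnm' := mul_left_cancel₀ Real.pi_ne_zero hnm
  norm_cast at hnm'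
  omega

theorem div_mem_slitPlane_of_norm_sub_lt {E : Type*} [NormedAddCommGroup E] [NormedSpace ℝ E]
    {T : E →ₗ[ℝ] ℂ} (hT : Injective T) {x y : E} (h : ‖x - y‖ < ‖y‖) :
    T x / T y ∈ slitPlane := by
  have hy : T y ≠ 0 := fun hy ↦ by
    rw [(map_eq_zero_iff T hT).1 hy, norm_zero] at h
    exact (norm_nonneg _).not_gt h
  by_contra hs
  rw [Complex.mem_slitPlane_iff, not_or, not_lt, not_not] at hs
  have hr : T x / T y = ((T x / T y).re : ℂ) := Complex.ext rfl (by simpa using hs.2)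
  set r := (T x / T y).re
  have hx : x = r • y := hT (by rw [map_smul, Complex.real_smul, ← hr, div_mul_cancel₀ _ hy])
  have hxy : x - y = (r - 1) • y := by rw [hx, sub_smul, one_smul]
  rw [hxy, norm_smul, Real.norm_eq_abs, abs_of_nonpos (by linarith [hs.1])] at h
  nlinarith [norm_nonneg y, hs.1]

/-- A continuous map on a closed ball of a normed space extends continuously to the whole space
with values in the image of the ball. -/
theorem ContinuousOn.exists_continuous_extension_closedBall {E X : Type*}
    [NormedAddCommGroup E] [NormedSpace ℝ E] [TopologicalSpace X] {R : ℝ} (hR : 0 < R)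
    {f : E → X} (hf : ContinuousOn f (Metric.closedBall 0 R)) :
    ∃ g : E → X, Continuous g ∧ EqOn g f (Metric.closedBall 0 R) ∧
      ∀ x, g x ∈ f '' Metric.closedBall 0 R := by
  have hpos : ∀ x : E, 0 < max R ‖x‖ := fun x ↦ lt_max_of_lt_left hR
  have hmem : ∀ x : E, (R / max R ‖x‖) • x ∈ Metric.closedBall (0 : E) R := fun x ↦ by
    rw [mem_closedBall_zero_iff, norm_smul, Real.norm_of_nonneg (div_pos hR (hpos x)).le,
      div_mul_eq_mul_div, div_le_iff₀ (hpos x)]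
    exact mul_le_mul_of_nonneg_left (le_max_right _ _) hR.le
  refine ⟨fun x ↦ f ((R / max R ‖x‖) • x), hf.comp_continuous ?_ hmem, fun x hx ↦ ?_,
    fun x ↦ mem_image_of_mem f (hmem x)⟩
  · exact (continuous_const.div (by fun_prop) fun x ↦ (hpos x).ne').smul continuous_id
  · rw [mem_closedBall_zero_iff] at hx
    simp only [max_eq_left hx, div_self hR.ne', one_smul]

/-- a Rouché-type consequence of the homotopy invariance of the Kronecker
index. If G is continuous on the closed disc D of radius R in ℝ², J(s) = a + A·s is affine
with invertible linear part and its (unique) zero lies in the open disc, and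
|G(s) − J(s)| < |J(s)| on the boundary circle, then G has a zero in D. -/
theorem rouche_kronecker_index
    (R : ℝ) (hR : 0 < R)
    (G : (Fin 2 → ℝ) → (Fin 2 → ℝ))
    (hG : ContinuousOn G (Metric.closedBall (0 : Fin 2 → ℝ) R))
    (a : Fin 2 → ℝ) (A : (Fin 2 → ℝ) →L[ℝ] (Fin 2 → ℝ))
    (hA : Function.Bijective A)
    (hzero : ∃ z₀ ∈ Metric.ball (0 : Fin 2 → ℝ) R, a + A z₀ = 0)
    (hbd : ∀ s : Fin 2 → ℝ, ‖s‖ = R → ‖G s - (a + A s)‖ < ‖a + A s‖) :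
    ∃ s' ∈ Metric.closedBall (0 : Fin 2 → ℝ) R, G s' = 0 := by
  by_contra! hG0
  obtain ⟨z₀, hz₀, hJ⟩ := hzero
  rw [mem_ball_zero_iff] at hz₀
  have hJ' : ∀ s, a + A s = A (s - z₀) := fun s ↦ by
    rw [map_sub, eq_sub_iff_add_eq, add_right_comm, hJ, zero_add]
  let e : (Fin 2 → ℝ) ≃L[ℝ] ℂ :=
    (ContinuousLinearEquiv.finTwoArrow ℝ ℝ).trans Complex.equivRealProdCLM.symm
  let B : (Fin 2 → ℝ) ≃L[ℝ] (Fin 2 → ℝ) :=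
    (LinearEquiv.ofBijective A.toLinearMap hA).toContinuousLinearEquiv
  have hB : ∀ x, B.symm (A x) = x := B.symm_apply_apply
  let T : (Fin 2 → ℝ) ≃L[ℝ] ℂ := B.symm.trans e
  obtain ⟨g, hg, hgG, hg0⟩ := hG.exists_continuous_extension_closedBall hR
  have hTg : ∀ x, T (g x) ≠ 0 := fun x ↦ by
    obtain ⟨y, hy, hyx⟩ := hg0 x
    simpa [← hyx] using hG0 y hy
  obtain ⟨L, hL, hLg⟩ := exists_continuous_exp_eq (T.continuous.comp hg) hTg
  let u : ℝ → (Fin 2 → ℝ) := fun θ ↦ e.symm (Complex.exp (θ * I))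
  have hu : Continuous u := by fun_prop
  have hu0 : ∀ θ, 0 < ‖u θ‖ := fun θ ↦ by simp [u]
  let γ : ℝ → (Fin 2 → ℝ) := fun θ ↦ (R / ‖u θ‖) • u θ
  have hγ : Continuous γ :=
    (continuous_const.div hu.norm fun θ ↦ (hu0 θ).ne').smul hu
  have hγR : ∀ θ, ‖γ θ‖ = R := fun θ ↦ by
    rw [norm_smul, Real.norm_of_nonneg (div_pos hR (hu0 θ)).le, div_mul_cancel₀ _ (hu0 θ).ne']
  have hgγ : ∀ θ, g (γ θ) = G (γ θ) := fun θ ↦ hgG (mem_closedBall_zero_iff.2 (hγR θ).le)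
  have heγ : ∀ θ, e (γ θ) = (R / ‖u θ‖ : ℝ) * Complex.exp (θ * I) := fun θ ↦ by
    simp only [γ, map_smul, u, e.apply_symm_apply, Complex.real_smul]
  have hγper : γ (2 * π) = γ 0 := by simp [γ, u]
  have slit₁ : ∀ θ, T (g (γ θ)) / e (γ θ - z₀) ∈ slitPlane := fun θ ↦ by
    have h := div_mem_slitPlane_of_norm_sub_lt (T := T.toLinearEquiv.toLinearMap)
      T.injective (hbd _ (hγR θ))
    rw [hgγ]
    simpa [hJ', T, hB, -map_sub] using h
  have slit₂ : ∀ θ, e (γ θ - z₀) / e (γ θ) ∈ slitPlane := fun θ ↦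
    div_mem_slitPlane_of_norm_sub_lt (T := e.toLinearEquiv.toLinearMap) e.injective
      (by rwa [sub_sub_cancel_left, norm_neg, hγR])
  have ne₁ : ∀ θ, e (γ θ - z₀) ≠ 0 := fun θ h ↦ by
    simpa [h] using slitPlane_ne_zero (slit₁ θ)
  have ne₂ : ∀ θ, e (γ θ) ≠ 0 := fun θ h ↦ by
    simpa [h] using slitPlane_ne_zero (slit₂ θ)
  refine not_exists_periodic_log
    (F := fun θ ↦ L (γ θ) - Complex.log (T (g (γ θ)) / e (γ θ - z₀))
      - Complex.log (e (γ θ - z₀) / e (γ θ))) ?_ ?_ (fun θ ↦ div_pos hR (hu0 θ)) fun θ ↦ ?_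
  · refine ((hL.comp hγ).sub (Continuous.clog ?_ slit₁)).sub (Continuous.clog ?_ slit₂)
    · exact Continuous.div (by fun_prop) (by fun_prop) ne₁
    · exact Continuous.div (by fun_prop) (by fun_prop) ne₂
  · simp only [hγper]
  · have h₁ := hTg (γ θ)
    have h₂ := ne₁ θ
    have h₃ := ne₂ θ
    rw [← heγ, Complex.exp_sub, Complex.exp_sub, Complex.exp_log (slitPlane_ne_zero (slit₁ θ)),
      Complex.exp_log (slitPlane_ne_zero (slit₂ θ)), hLg, Function.comp_apply]
    field_simp
end
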